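/- (Completeness of derivation with A1, A2, A3) If a clause set F is satisfiable, then there exists a derivation by the inference rules A1, A2, and A3, starting from the initial family of clause sets S₀ = {F}, that yields a complete and clash-free family of clause sets. -/

import Mathlib

/- Clause sets in ALC: a clause set is a finite set of clauses, a clause a
   finite set of concept literals (both represented by lists, with list
   membership as set membership, `++` as union and `filter` as removal). -/
namespace ALCCS

/-- Concept literals: A, ¬A, ∃R.F, ∀R.F where F is a clause set
    (concept names and role names are drawn from ℕ). -/
inductive Lit : Type where
  | pos : ℕ → Lit                    -- concept name A
  | neg : ℕ → Lit                    -- negated concept name ¬A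
  | ex  : ℕ → List (List Lit) → Lit  -- ∃R.F
  | all : ℕ → List (List Lit) → Lit  -- ∀R.F

/-- A clause: a finite set of concept literals (their disjunction). -/
abbrev Clause := List Lit
/-- A clause set: a finite set of clauses (their conjunction). -/
abbrev ClauseSet := List (List Lit)

/-- An interpretation with (nonempty) domain `D`. -/
structure Interp (D : Type) where
  cn  : ℕ → Set D
  rel : ℕ → D → D → Prop

mutual
/-- The extension L^I of a concept literal. -/
def litSem {D : Type} (I : Interp D) : Lit → Set D
  | .pos a => I.cn a
  | .neg a => (I.cn a)ᶜ
  | .ex r F => {x | ∃ y, I.rel r x y ∧ y ∈ csSem I F}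
  | .all r F => {x | ∀ y, I.rel r x y → y ∈ csSem I F}
/-- The extension of a clause: the union (disjunction) of its literals. -/
def clSem {D : Type} (I : Interp D) : List Lit → Set D
  | [] => ∅
  | L :: CL => litSem I L ∪ clSem I CL
/-- The extension of a clause set: the intersection (conjunction) of its clauses. -/
def csSem {D : Type} (I : Interp D) : List (List Lit) → Set D
  | [] => Set.univ
  | CL :: F => clSem I CL ∩ csSem I F
end

/-- A clause set is satisfiable if F^I ≠ ∅ for some interpretation. -/
def Satisfiable (F : ClauseSet) : Prop :=
  ∃ (D : Type), Nonempty D ∧ ∃ I : Interp D, (csSem I F).Nonempty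

/-- CNF of a disjunction of two clause sets (pairwise union of clauses). -/
def disjCS (F₁ F₂ : ClauseSet) : ClauseSet :=
  F₁.flatMap (fun c₁ => F₂.map (fun c₂ => c₁ ++ c₂))

mutual
/-- The complementary literal L̄: Ā = ¬A, (¬A)‾ = A, (∃R.F)‾ = ∀R.CNF(¬F),
    (∀R.F)‾ = ∃R.CNF(¬F). -/
def Lit.compl : Lit → Lit
  | .pos a => .neg a
  | .neg a => .pos a
  | .ex r F => .all r (csNeg F)
  | .all r F => .ex r (csNeg F)
/-- CNF of the negation of a clause: the conjunction of the complements. -/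
def clNeg : List Lit → List (List Lit)
  | [] => []
  | L :: CL => [L.compl] :: clNeg CL
/-- CNF(¬F) for a clause set F. -/
def csNeg : List (List Lit) → List (List Lit)
  | [] => [[]]
  | CL :: F => disjCS (clNeg CL) (csNeg F)
end

open Classical in
/-- Replace the clause `CL` by `newCL` in the clause set `F`. -/
noncomputable def replaceClause (F : ClauseSet) (CL newCL : Clause) : ClauseSet :=
  F.map (fun c => if c = CL then newCL else c)

open Classical in
/-- Replace the clause set `F` by `F'` in the family `S`. -/
noncomputable def replaceCS (S : List ClauseSet) (F F' : ClauseSet) : List ClauseSet :=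
  S.map (fun G => if G = F then F' else G)

open Classical in
/-- F \ {CL} : remove the clause `CL` from the clause set `F`. -/
noncomputable def removeClause (F : ClauseSet) (CL : Clause) : ClauseSet :=
  F.filter (fun c => decide (c ≠ CL))

open Classical in
/-- The effect of rule A2 (and A2⁺) on F for ∀R.F₁: remove from F all clauses
    containing ∀R.F₁ and replace every occurrence of ∃R.F₂ in clauses of F by
    ∃R.(F₁ ∪ F₂). -/
noncomputable def applyA2 (r : ℕ) (F₁ : ClauseSet) (F : ClauseSet) : ClauseSet :=
  (F.filter (fun CL => decide (Lit.all r F₁ ∉ CL))).map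
    (fun CL => CL.map (fun L => match L with
      | .ex r' F₂ => if r' = r then Lit.ex r' (F₁ ++ F₂) else Lit.ex r' F₂
      | L => L))

/-- A unit clause of the form {A}, {¬A}, or {∃R.F'}. -/
def IsA3Unit (CL : Clause) : Prop :=
  (∃ a, CL = [Lit.pos a]) ∨ (∃ a, CL = [Lit.neg a]) ∨ ∃ r F', CL = [Lit.ex r F']

/-- A family of clause sets is clash-free if none of its clause sets contains an
    empty clause or a pair {L}, {L̄} of complementary unit clauses. -/
def ClashFree (S : List ClauseSet) : Prop :=
  ∀ F ∈ S, [] ∉ F ∧ ¬ ∃ L : Lit, [L] ∈ F ∧ [L.compl] ∈ F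

/-- One derivation step Sᵢ → Sᵢ₊₁ of the reasoning algorithm with the inference
    rules A1, A2, and A3, acting on a clause set F ∈ Sᵢ. -/
inductive Step : List ClauseSet → List ClauseSet → Prop
  /-- (A1) if L ∈ CL for a clause CL of F (with |CL| ≥ 2), replace CL by {L} -/
  | a1 {S : List ClauseSet} {F : ClauseSet} {CL : Clause} {L : Lit} :
      F ∈ S → CL ∈ F → L ∈ CL → 2 ≤ CL.length →
      Step S (replaceCS S F (replaceClause F CL [L]))
  /-- (A2) if ∀R.F₁ occurs in some clause of F, remove all clauses containing
      ∀R.F₁ and replace every ∃R.F₂ by ∃R.(F₁ ∪ F₂) -/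
  | a2 {S : List ClauseSet} {F : ClauseSet} {CL : Clause} {r : ℕ} {F₁ : ClauseSet} :
      F ∈ S → CL ∈ F → Lit.all r F₁ ∈ CL →
      Step S (replaceCS S F (applyA2 r F₁ F))
  /-- (A3) if all clauses of F are unit clauses {A}, {¬A}, or {∃R.F'}, remove a
      unit clause {∃R.F₁} from F and add F₁ to the family -/
  | a3 {S : List ClauseSet} {F : ClauseSet} {r : ℕ} {F₁ : ClauseSet} :
      F ∈ S → (∀ CL ∈ F, IsA3Unit CL) → [Lit.ex r F₁] ∈ F →
      Step S (replaceCS S F (removeClause F [Lit.ex r F₁]) ++ [F₁])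

/-- A family is complete if no inference rule applies to it. -/
def Complete (S : List ClauseSet) : Prop := ¬ ∃ S', Step S S'

theorem mem_clSem {D : Type} {I : Interp D} {x : D} {CL : Clause} :
    x ∈ clSem I CL ↔ ∃ L ∈ CL, x ∈ litSem I L := by
  induction CL with
  | nil => simp [clSem]
  | cons L CL ih => simp [clSem, ih]

theorem mem_csSem {D : Type} {I : Interp D} {x : D} {F : ClauseSet} :
    x ∈ csSem I F ↔ ∀ CL ∈ F, x ∈ clSem I CL := by
  induction F with
  | nil => simp [csSem]
  | cons CL F ih => simp [csSem, ih]

mutual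
/-- The modal depth of a concept literal. -/
def litDepth : Lit → ℕ
  | .pos _ => 0
  | .neg _ => 0
  | .ex _ F => csDepth F + 1
  | .all _ F => csDepth F + 1
/-- The modal depth of a clause. -/
def clDepth : List Lit → ℕ
  | [] => 0
  | L :: CL => max (litDepth L) (clDepth CL)
/-- The modal depth of a clause set. -/
def csDepth : List (List Lit) → ℕ
  | [] => 0
  | CL :: F => max (clDepth CL) (csDepth F)
end

theorem clDepth_le {CL : Clause} {d : ℕ} :
    clDepth CL ≤ d ↔ ∀ L ∈ CL, litDepth L ≤ d := by
  induction CL with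
  | nil => simp [clDepth]
  | cons L CL ih => simp [clDepth, ih]

theorem csDepth_le {F : ClauseSet} {d : ℕ} :
    csDepth F ≤ d ↔ ∀ CL ∈ F, ∀ L ∈ CL, litDepth L ≤ d := by
  induction F with
  | nil => simp [csDepth]
  | cons CL F ih => simp [csDepth, ih, clDepth_le]

theorem litDepth_le_csDepth {F : ClauseSet} {CL : Clause} {L : Lit}
    (hCL : CL ∈ F) (hL : L ∈ CL) : litDepth L ≤ csDepth F :=
  csDepth_le.1 le_rfl CL hCL L hL

theorem csDepth_append (F G : ClauseSet) : csDepth (F ++ G) = max (csDepth F) (csDepth G) := by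
  induction F with
  | nil => simp [csDepth]
  | cons CL F ih => simp [csDepth, ih, max_assoc]

/-- The number of literal occurrences in a clause set. -/
def litCount (F : ClauseSet) : ℕ := (F.map List.length).sum

/-- The termination measure of a clause set: modal depth, then number of literal occurrences. -/
def rank (F : ClauseSet) : ℕ ×ₗ ℕ := toLex (csDepth F, litCount F)

theorem rank_lt_of_depth_le {F G : ClauseSet} (hd : csDepth G ≤ csDepth F)
    (hc : litCount G < litCount F) : rank G < rank F := by
  rw [rank, rank, Prod.Lex.toLex_lt_toLex]
  exact hd.lt_or_eq.imp id fun h => ⟨h, hc⟩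

theorem rank_lt_of_depth_lt {F G : ClauseSet} (hd : csDepth G < csDepth F) :
    rank G < rank F := by
  rw [rank, rank, Prod.Lex.toLex_lt_toLex]
  exact Or.inl hd

/-- Mapping the clauses of a filtered clause set to no longer clauses, while dropping or strictly
shortening at least one nonempty clause, decreases the number of literal occurrences. -/
theorem litCount_map_filter_lt {F : ClauseSet} {CL : Clause} (f : Clause → Clause)
    (p : Clause → Bool) (hf : ∀ c ∈ F, p c = true → (f c).length ≤ c.length) (hCL : CL ∈ F)
    (hlt : (p CL = true ∧ (f CL).length < CL.length) ∨ (p CL = false ∧ 0 < CL.length)) :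
    litCount ((F.filter p).map f) < litCount F := by
  have key : litCount ((F.filter p).map f)
      = (F.map fun c => if p c = true then (f c).length else 0).sum := by
    clear hf hCL
    induction F with
    | nil => rfl
    | cons c F ih =>
      cases h : p c <;> simp_all [litCount]
  rw [key]
  refine List.sum_lt_sum _ _ (fun c hc => ?_) ⟨CL, hCL, ?_⟩
  · split_ifs with h
    · exact hf c hc h
    · exact Nat.zero_le _
  · rcases hlt with ⟨h, h'⟩ | ⟨h, h'⟩ <;> simpa [h] using h'

theorem rank_replaceClause_lt {F : ClauseSet} {CL : Clause} {L : Lit} (hCL : CL ∈ F)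
    (hL : L ∈ CL) (h2 : 2 ≤ CL.length) : rank (replaceClause F CL [L]) < rank F := by
  apply rank_lt_of_depth_le
  · rw [csDepth_le]
    intro c hc M hM
    obtain ⟨c', hc', rfl⟩ := List.mem_map.1 hc
    split_ifs at hM with h
    · rw [List.mem_singleton.1 hM]
      exact litDepth_le_csDepth hCL hL
    · exact litDepth_le_csDepth hc' hM
  · have := litCount_map_filter_lt (F := F) (CL := CL)
      (fun c => open Classical in if c = CL then [L] else c) (fun _ => true)
      (fun c _ _ => by
        split_ifs with h
        · subst h
          simp only [List.length_singleton]
          omega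
        · exact le_rfl) hCL (Or.inl ⟨rfl, by simpa [Nat.lt_iff_add_one_le] using h2⟩)
    simpa [replaceClause] using this

theorem rank_applyA2_lt {F : ClauseSet} {CL : Clause} {r : ℕ} {F₁ : ClauseSet} (hCL : CL ∈ F)
    (hL : Lit.all r F₁ ∈ CL) : rank (applyA2 r F₁ F) < rank F := by
  apply rank_lt_of_depth_le
  · rw [csDepth_le]
    intro c hc M hM
    obtain ⟨c', hc', rfl⟩ := List.mem_map.1 hc
    obtain ⟨N, hN, rfl⟩ := List.mem_map.1 hM
    have hNd := litDepth_le_csDepth (List.mem_of_mem_filter hc') hN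
    have hAd := litDepth_le_csDepth hCL hL
    cases N with
    | ex r' F₂ =>
      dsimp only
      split_ifs
      · simp only [litDepth, csDepth_append] at *
        omega
      · exact hNd
    | _ => exact hNd
  · exact litCount_map_filter_lt _ _ (fun c _ _ => by simp) hCL
      (Or.inr ⟨by simpa using hL, List.length_pos_of_mem hL⟩)

theorem rank_removeClause_lt {F : ClauseSet} {CL : Clause} (hCL : CL ∈ F)
    (h : 0 < CL.length) : rank (removeClause F CL) < rank F := by
  apply rank_lt_of_depth_le
  · rw [csDepth_le]
    intro c hc M hM
    exact litDepth_le_csDepth (List.mem_of_mem_filter hc) hM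
  · have := litCount_map_filter_lt (F := F) (CL := CL) id
      (fun c => open Classical in decide (c ≠ CL)) (fun _ _ _ => le_rfl) hCL
      (Or.inr ⟨by simp, h⟩)
    simpa [removeClause] using this

theorem rank_lt_of_ex_mem {F F₁ : ClauseSet} {r : ℕ} (h : [Lit.ex r F₁] ∈ F) :
    rank F₁ < rank F :=
  rank_lt_of_depth_lt (Nat.lt_of_succ_le (litDepth_le_csDepth h (List.mem_singleton.2 rfl)))

theorem mem_csSem_replaceClause {D : Type} {I : Interp D} {x : D} {F : ClauseSet} {CL : Clause}
    {L : Lit} (hx : x ∈ csSem I F) (hL : x ∈ litSem I L) :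
    x ∈ csSem I (replaceClause F CL [L]) := by
  rw [mem_csSem] at hx ⊢
  intro c hc
  obtain ⟨c', hc', rfl⟩ := List.mem_map.1 hc
  split_ifs
  · exact mem_clSem.2 ⟨L, List.mem_singleton.2 rfl, hL⟩
  · exact hx c' hc'

theorem mem_csSem_applyA2 {D : Type} {I : Interp D} {x : D} {F F₁ : ClauseSet} {r : ℕ}
    (hx : x ∈ csSem I F) (hall : x ∈ litSem I (Lit.all r F₁)) :
    x ∈ csSem I (applyA2 r F₁ F) := by
  rw [mem_csSem] at hx ⊢
  intro c hc
  obtain ⟨c', hc', rfl⟩ := List.mem_map.1 hc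
  obtain ⟨L, hL, hxL⟩ := mem_clSem.1 (hx c' (List.mem_of_mem_filter hc'))
  refine mem_clSem.2 ⟨_, List.mem_map_of_mem hL, ?_⟩
  cases L with
  | ex r' F₂ =>
    dsimp only
    split_ifs with h
    · subst h
      simp only [litSem, Set.mem_ofPred_eq] at hall hxL ⊢
      obtain ⟨y, hxy, hy⟩ := hxL
      refine ⟨y, hxy, mem_csSem.2 fun C hC => ?_⟩
      rcases List.mem_append.1 hC with hC | hC
      · exact mem_csSem.1 (hall y hxy) C hC
      · exact mem_csSem.1 hy C hC
    · exact hxL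
  | _ => exact hxL

theorem satisfiable_removeClause {F : ClauseSet} (h : Satisfiable F) (CL : Clause) :
    Satisfiable (removeClause F CL) := by
  obtain ⟨D, hD, I, x, hx⟩ := h
  exact ⟨D, hD, I, x, mem_csSem.2 fun c hc => mem_csSem.1 hx c (List.mem_of_mem_filter hc)⟩

theorem satisfiable_of_ex_mem {F F₁ : ClauseSet} {r : ℕ} (h : Satisfiable F)
    (hex : [Lit.ex r F₁] ∈ F) : Satisfiable F₁ := by
  obtain ⟨D, hD, I, x, hx⟩ := h
  obtain ⟨L, hL, hxL⟩ := mem_clSem.1 (mem_csSem.1 hx _ hex)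
  rw [List.mem_singleton.1 hL, litSem] at hxL
  obtain ⟨y, -, hy⟩ := hxL
  exact ⟨D, hD, I, y, hy⟩

/-- The multiset of ranks of the members of a family. -/
def familyRank (S : List ClauseSet) : Multiset (ℕ ×ₗ ℕ) := (S : Multiset ClauseSet).map rank

theorem familyRank_replaceCS_append_lt {S E : List ClauseSet} {F F' : ClauseSet} (hF : F ∈ S)
    (hF' : rank F' < rank F) (hE : ∀ G ∈ E, rank G < rank F) :
    Multiset.IsDershowitzMannaLT (familyRank (replaceCS S F F' ++ E)) (familyRank S) := by
  classical
  refine ⟨((S : Multiset ClauseSet).filter (· ≠ F)).map rank,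
    ((S : Multiset ClauseSet).filter (· = F)).map (fun _ => rank F') + (E : Multiset _).map rank,
    ((S : Multiset ClauseSet).filter (· = F)).map rank, ?_, ?_, ?_, ?_⟩
  · intro h
    have : F ∈ (S : Multiset ClauseSet).filter (· = F) := by simpa using hF
    rw [Multiset.map_eq_zero.1 h] at this
    exact Multiset.notMem_zero _ this
  · rw [familyRank, ← Multiset.coe_add, Multiset.map_add, ← add_assoc, add_left_inj]
    clear hF
    induction S with
    | nil => rfl
    | cons G S ih =>
      by_cases h : G = F
      · simp_all [replaceCS, ← Multiset.cons_coe]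
      · simp_all [replaceCS, ← Multiset.cons_coe]
  · rw [familyRank, ← Multiset.map_add, add_comm, Multiset.filter_add_not]
  · intro y hy
    refine ⟨rank F, Multiset.mem_map_of_mem _ (by simpa using hF), ?_⟩
    rcases Multiset.mem_add.1 hy with hy | hy
    · obtain ⟨_, _, rfl⟩ := Multiset.mem_map.1 hy
      exact hF'
    · obtain ⟨G, hG, rfl⟩ := Multiset.mem_map.1 hy
      exact hE G (by simpa using hG)

theorem satisfiable_replaceCS {S : List ClauseSet} {F F' : ClauseSet}
    (hS : ∀ G ∈ S, Satisfiable G) (hF' : Satisfiable F') :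
    ∀ G ∈ replaceCS S F F', Satisfiable G := by
  intro G hG
  obtain ⟨G', hG', rfl⟩ := List.mem_map.1 hG
  split_ifs
  · exact hF'
  · exact hS G' hG'

/-- If a rule applies to a family of satisfiable clause sets, then some rule application keeps all
members satisfiable and decreases the rank of the family. -/
theorem exists_satisfiable_step {S S' : List ClauseSet} (hS : ∀ G ∈ S, Satisfiable G)
    (h : Step S S') : ∃ T, Step S T ∧ (∀ G ∈ T, Satisfiable G) ∧
      Multiset.IsDershowitzMannaLT (familyRank T) (familyRank S) := by
  have shorten : ∀ F ∈ S, ∀ CL ∈ F, 2 ≤ CL.length → ∃ T, Step S T ∧ (∀ G ∈ T, Satisfiable G) ∧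
      Multiset.IsDershowitzMannaLT (familyRank T) (familyRank S) := by
    intro F hF CL hCL h2
    obtain ⟨D, hD, I, x, hx⟩ := hS F hF
    obtain ⟨L, hL, hxL⟩ := mem_clSem.1 (mem_csSem.1 hx CL hCL)
    refine ⟨_, .a1 hF hCL hL h2,
      satisfiable_replaceCS hS ⟨D, hD, I, x, mem_csSem_replaceClause hx hxL⟩, ?_⟩
    simpa using familyRank_replaceCS_append_lt (E := []) hF (rank_replaceClause_lt hCL hL h2)
      (by simp)
  cases h with
  | a1 hF hCL hL h2 => exact shorten _ hF _ hCL h2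
  | @a2 F CL r F₁ hF hCL hL =>
    by_cases h2 : 2 ≤ CL.length
    · exact shorten _ hF _ hCL h2
    have hunit : CL = [Lit.all r F₁] := by
      match CL, hL, h2 with
      | [L], hL, _ => rw [List.mem_singleton.1 hL]
      | _ :: _ :: _, _, h2 => simp at h2
    obtain ⟨D, hD, I, x, hx⟩ := hS F hF
    obtain ⟨L, hL', hxL⟩ := mem_clSem.1 (mem_csSem.1 hx CL hCL)
    rw [hunit, List.mem_singleton] at hL'
    subst hL'
    refine ⟨_, .a2 hF hCL hL,
      satisfiable_replaceCS hS ⟨D, hD, I, x, mem_csSem_applyA2 hx hxL⟩, ?_⟩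
    simpa using familyRank_replaceCS_append_lt (E := []) hF (rank_applyA2_lt hCL hL) (by simp)
  | @a3 F r F₁ hF hunits hex =>
    refine ⟨_, .a3 hF hunits hex, fun G hG => ?_, familyRank_replaceCS_append_lt hF
      (rank_removeClause_lt hex (by simp)) (by simpa using rank_lt_of_ex_mem hex)⟩
    rcases List.mem_append.1 hG with hG | hG
    · exact satisfiable_replaceCS hS (satisfiable_removeClause (hS F hF) _) G hG
    · rw [List.mem_singleton.1 hG]
      exact satisfiable_of_ex_mem (hS F hF) hex

theorem clashFree_of_complete {S : List ClauseSet} (hS : ∀ G ∈ S, Satisfiable G)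
    (hc : Complete S) : ClashFree S := by
  intro F hF
  obtain ⟨D, hD, I, x, hx⟩ := hS F hF
  have hunit : ∀ L, [L] ∈ F → x ∈ litSem I L := fun L hL => by
    simpa [mem_clSem] using mem_csSem.1 hx _ hL
  have hall : ∀ r F₁, [Lit.all r F₁] ∉ F := fun r F₁ h =>
    hc ⟨_, .a2 hF h (List.mem_singleton.2 rfl)⟩
  refine ⟨fun h => by simpa [mem_clSem] using mem_csSem.1 hx _ h, ?_⟩
  rintro ⟨L, hL, hL'⟩
  cases L with
  | pos a =>
    have h := hunit _ hL
    have h' := hunit _ hL'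
    simp only [Lit.compl, litSem] at h h'
    exact h' h
  | neg a =>
    have h := hunit _ hL
    have h' := hunit _ hL'
    simp only [Lit.compl, litSem] at h h'
    exact h h'
  | ex r F₁ =>
    rw [Lit.compl] at hL'
    exact hall _ _ hL'
  | all r F₁ => exact hall _ _ hL

theorem exists_complete_clashFree (S : List ClauseSet) (hS : ∀ G ∈ S, Satisfiable G) :
    ∃ T, Relation.ReflTransGen Step S T ∧ Complete T ∧ ClashFree T := by
  induction S using (InvImage.wf familyRank
    Multiset.wellFounded_isDershowitzMannaLT).induction with
  | _ S ih =>
    by_cases hc : Complete S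
    · exact ⟨S, .refl, hc, clashFree_of_complete hS hc⟩
    · obtain ⟨S', hS'⟩ := not_not.1 hc
      obtain ⟨T, hT, hsat, hlt⟩ := exists_satisfiable_step hS hS'
      obtain ⟨U, hU, hU'⟩ := ih T hlt hsat
      exact ⟨U, .head hT hU, hU'⟩

/-- Completeness of derivation with A1, A2, A3: if F is
    satisfiable, some derivation from S₀ = {F} yields a complete and clash-free
    family of clause sets. -/
theorem completeness_A1_A2_A3 (F : ClauseSet) (h : Satisfiable F) :
    ∃ Sn : List ClauseSet,
      Relation.ReflTransGen Step [F] Sn ∧ Complete Sn ∧ ClashFree Sn := by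
  exact exists_complete_clashFree [F] (by simpa using h)

end ALCCS
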